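/- Let X be an n-poised set and let ℓ be an n-node line of X. Suppose there exists a maximal line M₀ of X such that no node of X lies on both M₀ and ℓ. Then for every maximal line M of X with M ≠ M₀, the number of nodes of M that use ℓ equals n − 1, i.e., |M ∩ X_ℓ| = n − 1. -/

import Mathlib

open MvPolynomial

/-- Points of the plane `ℝ²`. -/
abbrev Pt : Type := Fin 2 → ℝ

/-- Bivariate real polynomials. -/
abbrev BPoly : Type := MvPolynomial (Fin 2) ℝ

/-- `X` is an `n`-poised node set: it has `N = (n+1)(n+2)/2` nodes and every
interpolation problem with polynomials of total degree at most `n` has a unique solution. -/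
def IsPoised (n : ℕ) (X : Set Pt) : Prop :=
  X.ncard = (n + 1) * (n + 2) / 2 ∧
  ∀ c : Pt → ℝ, ∃! p : BPoly, p.totalDegree ≤ n ∧ ∀ A ∈ X, eval A p = c A

/-- `p` is an `n`-fundamental polynomial of the node `A` for the node set `X`. -/
def IsFund (n : ℕ) (X : Set Pt) (A : Pt) (p : BPoly) : Prop :=
  p.totalDegree ≤ n ∧ eval A p = 1 ∧ ∀ B ∈ X, B ≠ A → eval B p = 0

/-- `X` is a `GC_n` set: it is `n`-poised and each node has a fundamental polynomial
that is a product of `n` polynomials of degree `1`. -/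
def IsGC (n : ℕ) (X : Set Pt) : Prop :=
  IsPoised n X ∧
  ∀ A ∈ X, ∃ p : BPoly, IsFund n X A p ∧
    ∃ f : Fin n → BPoly, (∀ i, (f i).totalDegree = 1) ∧ p = ∏ i, f i

/-- A line is the zero set of a polynomial of degree exactly `1`. -/
def IsLine (L : Set Pt) : Prop :=
  ∃ f : BPoly, f.totalDegree = 1 ∧ L = {x : Pt | eval x f = 0}

/-- A `k`-node line of `X`: a line passing through exactly `k` nodes of `X`. -/
def IsNodeLine (k : ℕ) (X : Set Pt) (L : Set Pt) : Prop :=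
  IsLine L ∧ (X ∩ L).ncard = k

/-- A maximal line of an `n`-poised set `X`: an `(n+1)`-node line. -/
def IsMaxLine (n : ℕ) (X : Set Pt) (L : Set Pt) : Prop :=
  IsNodeLine (n + 1) X L

/-- The node `A` uses the line `L`: a degree-1 polynomial whose zero set is `L`
divides the `n`-fundamental polynomial of `A` with respect to `X`. -/
def Uses (n : ℕ) (X : Set Pt) (L : Set Pt) (A : Pt) : Prop :=
  ∃ p f : BPoly, IsFund n X A p ∧ f.totalDegree = 1 ∧ L = {x : Pt | eval x f = 0} ∧ f ∣ p

/-- `X_ℓ`: the set of nodes of `X` that use the line `L`. -/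
def UseSet (n : ℕ) (X : Set Pt) (L : Set Pt) : Set Pt :=
  {A ∈ X | Uses n X L A}

theorem BPoly.exists_eq_of_totalDegree_eq_one {f : BPoly} (hf : f.totalDegree = 1) :
    ∃ a b c : ℝ, f = C a * X 0 + C b * X 1 + C c ∧ a ^ 2 + b ^ 2 ≠ 0 := by
  obtain ⟨a, b, c, h⟩ : ∃ a b c : ℝ, f = C a * X 0 + C b * X 1 + C c := by
    refine ⟨coeff (Finsupp.single 0 1) f, coeff (Finsupp.single 1 1) f, coeff 0 f, ?_⟩
    ext m
    simp only [coeff_add, coeff_C_mul, coeff_X, coeff_C]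
    by_cases hm : m.degree ≤ 1
    · have hd : m 0 + m 1 ≤ 1 := by simpa [Finsupp.degree_eq_sum] using hm
      obtain h | h | h : (m 0 = 0 ∧ m 1 = 0) ∨ (m 0 = 1 ∧ m 1 = 0) ∨ (m 0 = 0 ∧ m 1 = 1) := by
        omega
      · obtain rfl : m = 0 := by
          ext i; fin_cases i <;> simp [h]
        simp
      · obtain rfl : m = Finsupp.single 0 1 := by
          ext i; fin_cases i <;> simp [h]
        simp [Finsupp.single_left_inj, eq_comm (a := (0 : Fin 2 →₀ ℕ))]
      · obtain rfl : m = Finsupp.single 1 1 := by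
          ext i; fin_cases i <;> simp [h]
        simp [Finsupp.single_left_inj, eq_comm (a := (0 : Fin 2 →₀ ℕ))]
    · have h0 : coeff m f = 0 := coeff_eq_zero_of_totalDegree_lt (by
        rw [hf]; exact not_le.1 hm)
      have h1 : 0 ≠ m := by rintro rfl; simp at hm
      have h2 (i : Fin 2) : Finsupp.single i 1 ≠ m := by rintro rfl; simp at hm
      simp [h0, h1, h2]
  refine ⟨a, b, c, h, fun hab => ?_⟩
  have ha : a = 0 := by nlinarith [sq_nonneg a, sq_nonneg b]
  have hb : b = 0 := by nlinarith [sq_nonneg a, sq_nonneg b]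
  simp [h, ha, hb] at hf

/-- A polynomial of degree less than the number of its zeros on a line is divisible by
the equation of this line. -/
theorem BPoly.dvd_of_totalDegree_lt_ncard {f p : BPoly} (hf : f.totalDegree = 1) {S : Set Pt}
    (hS : p.totalDegree < S.ncard) (hfS : ∀ x ∈ S, eval x f = 0)
    (hpS : ∀ x ∈ S, eval x p = 0) : f ∣ p := by
  obtain ⟨a, b, c, hfe, hab⟩ := exists_eq_of_totalDegree_eq_one hf
  obtain ⟨P, hP⟩ : S.Nonempty := Set.nonempty_of_ncard_ne_zero (by omega)
  have hfin : S.Finite := Set.finite_of_ncard_ne_zero (by omega)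
  have := hfin.fintype
  have hline : ∀ x ∈ S, a * x 0 + b * x 1 + c = 0 := fun x hx => by
    simpa [hfe] using hfS x hx
  have hc := hline P hP
  let v : Fin 2 → ℝ := ![-b, a]
  let g : Fin 2 → Polynomial ℝ := fun i => Polynomial.C (P i) + Polynomial.C (v i) * Polynomial.X
  let t : Pt → ℝ := fun x => (-b * (x 0 - P 0) + a * (x 1 - P 1)) / (a ^ 2 + b ^ 2)
  have ht : ∀ x ∈ S, ∀ i, P i + v i * t x = x i := by
    intro x hx i
    have := hline x hx
    fin_cases i
    · simp only [v, t]
      field_simp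
      simp
      linear_combination a * (hc - this)
    · simp only [v, t]
      field_simp
      simp
      linear_combination b * (hc - this)
  have hzero : aeval g p = 0 := by
    refine Polynomial.eq_zero_of_natDegree_lt_card_of_eval_eq_zero _
      (f := fun x : S => t x) ?_ ?_ ?_
    · intro x y hxy
      ext i
      rw [← ht x x.2, ← ht y y.2]
      simp only at hxy
      rw [hxy]
    · intro x
      have h := hpS x x.2
      rw [← Polynomial.coe_evalRingHom, map_aeval]
      have : (fun i => Polynomial.evalRingHom (t x) (g i)) = (x : Pt) := by
        ext i
        simpa [g] using ht x x.2 i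
      rw [this]
      have h2 : (Polynomial.evalRingHom (t x)).comp (algebraMap ℝ (Polynomial ℝ)) =
          RingHom.id ℝ := by ext; simp
      rw [h2]
      exact h
    · rw [← Nat.card_eq_fintype_card, Nat.card_coe_set_eq]
      exact (aeval_natDegree_le p le_rfl g (fun i => by
        simp only [g]; compute_degree)).trans_lt (by simpa using hS)
  let I : Ideal BPoly := Ideal.span {f}
  let T : BPoly := C (a ^ 2 + b ^ 2)⁻¹ * (C (-b) * (X 0 - C (P 0)) + C a * (X 1 - C (P 1)))
  have hcomp : ((Polynomial.aeval (Ideal.Quotient.mkₐ ℝ I T)).comp (aeval g) :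
      BPoly →ₐ[ℝ] BPoly ⧸ I) = Ideal.Quotient.mkₐ ℝ I := by
    ext i
    rw [AlgHom.comp_apply, aeval_X]
    simp only [g, map_add, map_mul, Polynomial.aeval_C, Polynomial.aeval_X]
    change Ideal.Quotient.mk I (C (P i) + C (v i) * T) = Ideal.Quotient.mk I (X i)
    rw [Ideal.Quotient.eq, Ideal.mem_span_singleton]
    have hinv : (C (a ^ 2 + b ^ 2)⁻¹ * (C a ^ 2 + C b ^ 2) : BPoly) = 1 := by
      rw [← C_pow, ← C_pow, ← C_add, ← C_mul, inv_mul_cancel₀ hab, C_1]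
    have hcC : (C a * C (P 0) + C b * C (P 1) + C c : BPoly) = 0 := by
      rw [← C_mul, ← C_mul, ← C_add, ← C_add, hc, C_0]
    fin_cases i
    · refine ⟨-C (a ^ 2 + b ^ 2)⁻¹ * C a, ?_⟩
      simp only [v, T, hfe]
      simp
      linear_combination (X 0 - C (P 0)) * hinv + C (a ^ 2 + b ^ 2)⁻¹ * C a * hcC
    · refine ⟨-C (a ^ 2 + b ^ 2)⁻¹ * C b, ?_⟩
      simp only [v, T, hfe]
      simp
      linear_combination (X 1 - C (P 1)) * hinv + C (a ^ 2 + b ^ 2)⁻¹ * C b * hcC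
  have := DFunLike.congr_fun hcomp p
  rw [AlgHom.comp_apply, hzero, map_zero] at this
  exact Ideal.mem_span_singleton.1 (Ideal.Quotient.eq_zero_iff_mem.1 this.symm)

theorem BPoly.totalDegree_lt_of_mul {n : ℕ} {f q : BPoly} (hf : f.totalDegree = 1)
    (h0 : f * q ≠ 0) (h : (f * q).totalDegree ≤ n) : q.totalDegree < n := by
  rw [totalDegree_mul_of_isDomain (left_ne_zero_of_mul h0) (right_ne_zero_of_mul h0), hf] at h
  omega

theorem IsFund.ne_zero {n : ℕ} {X : Set Pt} {A : Pt} {p : BPoly} (hp : IsFund n X A p) :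
    p ≠ 0 := by
  rintro rfl
  simpa using hp.2.1

theorem IsPoised.exists_isFund {n : ℕ} {X : Set Pt} (hX : IsPoised n X) {A : Pt} (hA : A ∈ X) :
    ∃ p, IsFund n X A p := by
  classical
  obtain ⟨p, ⟨hd, hp⟩, -⟩ := hX.2 fun B => if B = A then 1 else 0
  exact ⟨p, hd, by simpa using hp A hA, fun B hB hBA => by simpa [hBA] using hp B hB⟩

theorem IsLine.subset_of_mem {L L' : Set Pt} (hL : IsLine L) (hL' : IsLine L') {A B : Pt}
    (hAB : A ≠ B) (hA : A ∈ L ∩ L') (hB : B ∈ L ∩ L') : L ⊆ L' := by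
  obtain ⟨f, hf, rfl⟩ := hL
  obtain ⟨g, hg, rfl⟩ := hL'
  obtain ⟨q, rfl⟩ : f ∣ g := by
    refine BPoly.dvd_of_totalDegree_lt_ncard hf (S := {A, B}) ?_ ?_ ?_
    · rw [hg, Set.ncard_pair hAB]; norm_num
    · rintro x (rfl | rfl)
      exacts [hA.1, hB.1]
    · rintro x (rfl | rfl)
      exacts [hA.2, hB.2]
  intro x hx
  simp_all

theorem IsLine.inter_subsingleton {L L' : Set Pt} (hL : IsLine L) (hL' : IsLine L')
    (hne : L ≠ L') : (L ∩ L').Subsingleton := by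
  intro A hA B hB
  by_contra hAB
  exact hne ((hL.subset_of_mem hL' hAB hA hB).antisymm
    (hL'.subset_of_mem hL hAB hA.symm hB.symm))

/-- The equation of a maximal line divides the fundamental polynomial of
each node outside the line. -/
theorem IsMaxLine.dvd_of_isFund {n : ℕ} {X M : Set Pt} (hM : IsMaxLine n X M) {m p : BPoly}
    (hm : m.totalDegree = 1) (hMm : M = {x | eval x m = 0}) {A : Pt} (hA : A ∉ M)
    (hp : IsFund n X A p) : m ∣ p := by
  refine BPoly.dvd_of_totalDegree_lt_ncard hm (S := X ∩ M) ?_ ?_ ?_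
  · rw [hM.2]
    exact Nat.lt_succ_of_le hp.1
  · rintro x ⟨-, hx⟩
    rwa [hMm] at hx
  · rintro x ⟨hxX, hx⟩
    exact hp.2.2 x hxX (by rintro rfl; exact hA hx)

theorem Uses.notMem {n : ℕ} {X L : Set Pt} {A : Pt} (h : Uses n X L A) : A ∉ L := by
  obtain ⟨p, f, hp, -, rfl, q, rfl⟩ := h
  intro hA
  have h1 := hp.2.1
  rw [map_mul, show eval A f = 0 from hA, zero_mul] at h1
  exact zero_ne_one h1

/-- A node of a maximal line `M` uses no line that has no node in common with `M`. -/
theorem IsMaxLine.not_uses {n : ℕ} {X M L : Set Pt} (hM : IsMaxLine n X M)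
    (hdisj : M ∩ L ∩ X = ∅) {A : Pt} (hAX : A ∈ X) (hAM : A ∈ M) : ¬ Uses n X L A := by
  rintro ⟨p, f, hp, hf, rfl, q, rfl⟩
  obtain ⟨⟨m, hm, rfl⟩, hcard⟩ := hM
  have hq := BPoly.totalDegree_lt_of_mul hf hp.ne_zero hp.1
  obtain ⟨r, rfl⟩ : m ∣ q := by
    refine BPoly.dvd_of_totalDegree_lt_ncard hm (S := (X ∩ {x | eval x m = 0}) \ {A}) ?_ ?_ ?_
    · rw [Set.ncard_sdiff_singleton_of_mem (show A ∈ X ∩ _ from ⟨hAX, hAM⟩), hcard]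
      exact hq
    · rintro x ⟨⟨-, hx⟩, -⟩
      exact hx
    · rintro x ⟨⟨hxX, hx⟩, hxA⟩
      have h := hp.2.2 x hxX hxA
      rw [map_mul] at h
      exact (mul_eq_zero.1 h).resolve_left fun hfx =>
        Set.eq_empty_iff_forall_notMem.1 hdisj x ⟨⟨hx, hfx⟩, hxX⟩
  have h1 := hp.2.1
  simp [show eval A m = 0 from hAM] at h1

/-- If an `n`-node line has no node in common with a maximal line, then every node lying on
neither of them uses the `n`-node line. -/
theorem IsNodeLine.uses_of_disjoint {n : ℕ} {X M L : Set Pt} (hX : IsPoised n X)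
    (hL : IsNodeLine n X L) (hM : IsMaxLine n X M) (hdisj : M ∩ L ∩ X = ∅) {A : Pt}
    (hAX : A ∈ X) (hAM : A ∉ M) (hAL : A ∉ L) : Uses n X L A := by
  obtain ⟨p, hp⟩ := hX.exists_isFund hAX
  obtain ⟨m, hm, hMm⟩ := hM.1
  obtain ⟨⟨f, hf, rfl⟩, hcard⟩ := hL
  refine ⟨p, f, hp, hf, rfl, ?_⟩
  obtain ⟨q, rfl⟩ := hM.dvd_of_isFund hm hMm hAM hp
  refine Dvd.dvd.mul_left (BPoly.dvd_of_totalDegree_lt_ncard hf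
    (S := X ∩ {x | eval x f = 0}) ?_ ?_ ?_) m
  · rw [hcard]
    exact BPoly.totalDegree_lt_of_mul hm hp.ne_zero hp.1
  · exact fun x hx => hx.2
  · rintro x ⟨hxX, hx⟩
    have h := hp.2.2 x hxX (by rintro rfl; exact hAL hx)
    rw [map_mul] at h
    refine (mul_eq_zero.1 h).resolve_left fun hmx => ?_
    exact Set.eq_empty_iff_forall_notMem.1 hdisj x ⟨⟨hMm ▸ hmx, hx⟩, hxX⟩

theorem IsNodeLine.useSet_eq {n : ℕ} {X M L : Set Pt} (hX : IsPoised n X)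
    (hL : IsNodeLine n X L) (hM : IsMaxLine n X M) (hdisj : M ∩ L ∩ X = ∅) :
    UseSet n X L = (X \ M) \ L := by
  ext A
  refine ⟨fun h => ⟨⟨h.1, fun hAM => ?_⟩, h.2.notMem⟩, fun h => ⟨h.1.1, ?_⟩⟩
  · exact hM.not_uses hdisj h.1 hAM h.2
  · exact hL.uses_of_disjoint hX hM hdisj h.1.1 h.1.2 h.2

/-- Two maximal lines of a poised set share a node. -/
theorem IsMaxLine.inter_nonempty {n : ℕ} {X M M' : Set Pt} (hX : IsPoised n X)
    (hM : IsMaxLine n X M) (hM' : IsMaxLine n X M') : (M ∩ M' ∩ X).Nonempty := by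
  by_contra! hdisj
  obtain ⟨A, hAX, hAM⟩ : (X ∩ M).Nonempty :=
    Set.nonempty_of_ncard_ne_zero (by rw [hM.2]; omega)
  have hAM' : A ∉ M' := fun h => Set.eq_empty_iff_forall_notMem.1 hdisj A ⟨⟨hAM, h⟩, hAX⟩
  obtain ⟨p, hp⟩ := hX.exists_isFund hAX
  obtain ⟨m, hm, hMm⟩ := hM'.1
  exact hM.not_uses hdisj hAX hAM ⟨p, m, hp, hm, hMm, hM'.dvd_of_isFund hm hMm hAM' hp⟩

/-- Let `X` be an `n`-poised set, `ℓ` an `n`-node line, and `M₀` a maximal line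
with `M₀ ∩ ℓ ∩ X = ∅`. Then every maximal line `M ≠ M₀` satisfies `|M ∩ X_ℓ| = n - 1`. -/
theorem maxLine_inter_useSet_card_of_disjoint (n : ℕ) (X ℓ M₀ : Set Pt)
    (hX : IsPoised n X) (hℓ : IsNodeLine n X ℓ)
    (hM₀ : IsMaxLine n X M₀) (hdisj : M₀ ∩ ℓ ∩ X = ∅) :
    ∀ M : Set Pt, IsMaxLine n X M → M ≠ M₀ →
      (M ∩ UseSet n X ℓ).ncard = n - 1 := by
  intro M hM hne
  obtain ⟨a, ⟨haM, ha₀⟩, haX⟩ := hM.inter_nonempty hX hM₀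
  have hinter : X ∩ M ∩ M₀ = {a} := by
    ext x
    refine ⟨fun h => hM.1.inter_subsingleton hM₀.1 hne ⟨h.1.2, h.2⟩ ⟨haM, ha₀⟩, ?_⟩
    rintro rfl
    exact ⟨⟨haX, haM⟩, ha₀⟩
  have hn : ((X ∩ M) \ {a}).ncard = n := by
    rw [Set.ncard_sdiff_singleton_of_mem (show a ∈ X ∩ M from ⟨haX, haM⟩), hM.2,
      Nat.add_sub_cancel]
  have huse : M ∩ UseSet n X ℓ = ((X ∩ M) \ {a}) \ ℓ := by
    rw [hℓ.useSet_eq hX hM₀ hdisj, ← hinter]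
    ext x
    simp only [Set.mem_inter_iff, Set.mem_sdiff]
    tauto
  rcases Set.eq_empty_or_nonempty (M ∩ ℓ ∩ X) with hempty | ⟨b, ⟨hbM, hbℓ⟩, hbX⟩
  · have h0 : M ∩ UseSet n X ℓ = ∅ := by
      ext x
      simp only [Set.mem_empty_iff_false, iff_false]
      exact fun h => hM.not_uses hempty h.2.1 h.1 h.2.2
    have h1 : ((X ∩ M) \ {a}) \ ℓ = (X ∩ M) \ {a} := by
      refine sdiff_eq_left.2 (Set.disjoint_left.2 fun x hx hxℓ => ?_)
      exact Set.eq_empty_iff_forall_notMem.1 hempty x ⟨⟨hx.1.2, hxℓ⟩, hx.1.1⟩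
    rw [h0, h1] at huse
    rw [h0, Set.ncard_empty]
    rw [← huse, Set.ncard_empty] at hn
    omega
  · have hMℓ : M ≠ ℓ := by
      rintro rfl
      have := hM.2.symm.trans hℓ.2
      omega
    have hba : b ≠ a := by
      rintro rfl
      exact Set.eq_empty_iff_forall_notMem.1 hdisj b ⟨⟨ha₀, hbℓ⟩, hbX⟩
    have h1 : ((X ∩ M) \ {a}) \ ℓ = ((X ∩ M) \ {a}) \ {b} := by
      ext x
      refine and_congr_right fun hx => not_congr ⟨fun hxℓ => ?_, ?_⟩
      · exact hM.1.inter_subsingleton hℓ.1 hMℓ ⟨hx.1.2, hxℓ⟩ ⟨hbM, hbℓ⟩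
      · rintro rfl
        exact hbℓ
    rw [huse, h1,
      Set.ncard_sdiff_singleton_of_mem (show b ∈ (X ∩ M) \ {a} from ⟨⟨hbX, hbM⟩, hba⟩), hn]
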